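/- For all δ,ε>0 there exist Δ₀=Δ₀(δ,ε) and C=C(δ,ε) such that for all Δ≥Δ₀, all 0<λ<(1−δ)·λ_c(Δ), and every finite graph G of maximum degree Δ and girth at least 6, the following holds. There exists q* ∈ [0,1]^{Ē} such that for every integer t≥C, every p∈V and every v∈N(p): |q^t(v,p)/q*(v,p) − 1| ≤ ε and |q*(v,p)/q̃*(v) − 1| ≤ ε, where the BP messages are started from any initial values R⁰_{v→p} ∈ [0,λ], q̃*(v) = λ·ω*(v)/(1+λ·ω*(v)), and ω* is the unique fixed point of the belief-propagation operator F. -/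

import Mathlib

open scoped BigOperators

noncomputable section

namespace HardCore

/-- The critical fugacity `λ_c(Δ) = (Δ-1)^(Δ-1) / (Δ-2)^Δ`. -/
def lambdaC (D : ℕ) : ℝ := ((D : ℝ) - 1) ^ (D - 1) / ((D : ℝ) - 2) ^ D

variable {V : Type} [Fintype V] [DecidableEq V]

/-- One iteration of the loopy BP message updates:
`R'_{v→p} = λ · ∏_{w ∈ N(v)\{p}} 1/(1 + R_{w→v})`. -/
def bpIter (G : SimpleGraph V) [DecidableRel G.Adj] (lam : ℝ) (R : V → V → ℝ) :
    V → V → ℝ :=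
  fun v p => lam * ∏ w ∈ (G.neighborFinset v).erase p, (1 + R w v)⁻¹

/-- The (parentless) belief-propagation operator `F(ω)(v) = ∏_{u ∈ N(v)} 1/(1 + λ·ω(u))`. -/
def bpF (G : SimpleGraph V) [DecidableRel G.Adj] (lam : ℝ) (ω : V → ℝ) : V → ℝ :=
  fun v => ∏ u ∈ G.neighborFinset v, (1 + lam * ω u)⁻¹

end HardCore

open HardCore

lemma inv_one_add_le_exp {lam r : ℝ} (hr : 0 ≤ r) (hrl : r ≤ lam) :
    (1 + r)⁻¹ ≤ Real.exp (-(r / (1 + lam))) := by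
  have h1 : 0 < 1 + r := by linarith
  have h2 : 1 - r / (1 + r) ≤ Real.exp (-(r / (1 + r))) := Real.one_sub_le_exp_neg _
  have h3 : 1 - r / (1 + r) = (1 + r)⁻¹ := by field_simp; ring
  have h4 : r / (1 + lam) ≤ r / (1 + r) := by gcongr
  calc (1 + r)⁻¹ ≤ Real.exp (-(r / (1 + r))) := h3 ▸ h2
    _ ≤ _ := Real.exp_le_exp.2 (by linarith)

lemma mul_exp_neg_div_le {c S : ℝ} (hc : 0 < c) :
    S * Real.exp (-(S / c)) ≤ c * Real.exp (-1) := by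
  have h := Real.add_one_le_exp (S / c - 1)
  have h1 : S ≤ c * Real.exp (S / c - 1) := by
    have : S = c * (S / c - 1 + 1) := by field_simp; ring
    calc S = c * (S / c - 1 + 1) := this
      _ ≤ _ := by gcongr
  calc S * Real.exp (-(S / c)) ≤ c * Real.exp (S / c - 1) * Real.exp (-(S / c)) := by gcongr
    _ = c * Real.exp (-1) := by rw [mul_assoc, ← Real.exp_add]; ring_nf

/-- The square-root potential bounds the gradient of one message update. -/
lemma sqrt_update_mul_sum_le {ι : Type*} (s : Finset ι) {lam κ : ℝ} (hlam : 0 < lam) (hκ : 0 ≤ κ)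
    (hs : lam * s.card * (1 + lam) ≤ κ ^ 2 * Real.exp 1) (u : ι → ℝ)
    (hul : ∀ i ∈ s, u i ^ 2 ≤ lam) :
    √(lam * ∏ i ∈ s, (1 + u i ^ 2)⁻¹) * ∑ i ∈ s, u i ≤ κ := by
  have hprod : ∏ i ∈ s, (1 + u i ^ 2)⁻¹ ≤ Real.exp (-((∑ i ∈ s, u i ^ 2) / (1 + lam))) := by
    rw [Finset.sum_div, ← Finset.sum_neg_distrib, Real.exp_sum]
    exact Finset.prod_le_prod (fun i _ => by positivity)
      fun i hi => inv_one_add_le_exp (sq_nonneg _) (hul i hi)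
  have hsum : (∑ i ∈ s, u i) ^ 2 ≤ s.card * ∑ i ∈ s, u i ^ 2 := sq_sum_le_card_mul_sum_sq
  refine le_of_sq_le_sq ?_ hκ
  have hp0 : 0 ≤ lam * ∏ i ∈ s, (1 + u i ^ 2)⁻¹ := by positivity
  rw [mul_pow, Real.sq_sqrt hp0]
  have hS : 0 ≤ ∑ i ∈ s, u i ^ 2 := by positivity
  generalize ∑ i ∈ s, u i ^ 2 = S at *
  calc (lam * ∏ i ∈ s, (1 + u i ^ 2)⁻¹) * (∑ i ∈ s, u i) ^ 2
      ≤ lam * Real.exp (-(S / (1 + lam))) * (s.card * S) := by gcongr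
    _ = lam * s.card * (S * Real.exp (-(S / (1 + lam)))) := by ring
    _ ≤ lam * s.card * ((1 + lam) * Real.exp (-1)) := by
        exact mul_le_mul_of_nonneg_left (mul_exp_neg_div_le (by linarith))
          (by positivity)
    _ = lam * s.card * (1 + lam) * Real.exp (-1) := by ring
    _ ≤ κ ^ 2 * Real.exp 1 * Real.exp (-1) := by gcongr
    _ = κ ^ 2 := by rw [mul_assoc, ← Real.exp_add]; simp

lemma hasDerivAt_sqrt_update {ι : Type*} (s : Finset ι) {lam : ℝ} (hlam : 0 < lam)
    (x h : ι → ℝ) (τ : ℝ) :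
    HasDerivAt (fun τ => √(lam * ∏ i ∈ s, (1 + (x i + τ * h i) ^ 2)⁻¹))
      (-(√(lam * ∏ i ∈ s, (1 + (x i + τ * h i) ^ 2)⁻¹) *
        ∑ i ∈ s, (x i + τ * h i) * h i / (1 + (x i + τ * h i) ^ 2))) τ := by
  have hpos : ∀ i τ, 0 < 1 + (x i + τ * h i) ^ 2 := fun i τ => by positivity
  have key : ∀ τ, √(lam * ∏ i ∈ s, (1 + (x i + τ * h i) ^ 2)⁻¹) =
      √lam * Real.exp (-(∑ i ∈ s, Real.log (1 + (x i + τ * h i) ^ 2)) / 2) := by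
    intro τ
    rw [Real.sqrt_mul hlam.le, Real.exp_half, ← Finset.sum_neg_distrib, Real.exp_sum]
    congr 2
    refine Finset.prod_congr rfl fun i _ => ?_
    rw [Real.exp_neg, Real.exp_log (hpos i τ)]
  have hlin : ∀ i, HasDerivAt (fun τ => x i + τ * h i) (h i) τ := fun i => by
    simpa using ((hasDerivAt_id τ).mul_const (h i)).const_add (x i)
  have hlog : ∀ i ∈ s, HasDerivAt (fun τ => Real.log (1 + (x i + τ * h i) ^ 2))
      (2 * ((x i + τ * h i) * h i / (1 + (x i + τ * h i) ^ 2))) τ := fun i _ => by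
    refine ((((hlin i).fun_pow 2).const_add 1).log (hpos i τ).ne').congr_deriv ?_
    push_cast
    ring
  have hD := ((HasDerivAt.fun_sum hlog).fun_neg.div_const 2).exp.const_mul √lam
  have hfun : (fun τ => √(lam * ∏ i ∈ s, (1 + (x i + τ * h i) ^ 2)⁻¹)) = fun τ =>
      √lam * Real.exp (-(∑ i ∈ s, Real.log (1 + (x i + τ * h i) ^ 2)) / 2) := funext key
  rw [hfun, key τ]
  refine hD.congr_deriv ?_
  rw [← Finset.mul_sum]
  ring

/-- One message update is a contraction in the square-root potential. -/
lemma abs_sqrt_update_sub_le {ι : Type*} (s : Finset ι) {lam κ M : ℝ} (hlam : 0 < lam)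
    (hκ : 0 ≤ κ) (hs : lam * s.card * (1 + lam) ≤ κ ^ 2 * Real.exp 1) (a b : ι → ℝ)
    (ha : ∀ i ∈ s, a i ∈ Set.Icc 0 lam) (hb : ∀ i ∈ s, b i ∈ Set.Icc 0 lam)
    (hM : ∀ i ∈ s, |√(a i) - √(b i)| ≤ M) (hM0 : 0 ≤ M) :
    |√(lam * ∏ i ∈ s, (1 + a i)⁻¹) - √(lam * ∏ i ∈ s, (1 + b i)⁻¹)| ≤ κ * M := by
  set h : ι → ℝ := fun i => √(a i) - √(b i) with hh
  have hmv := (convex_Icc (0 : ℝ) 1).norm_image_sub_le_of_norm_hasDerivWithin_le (C := κ * M)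
    (fun τ _ => (hasDerivAt_sqrt_update s hlam (fun i => √(b i)) h τ).hasDerivWithinAt) ?_
    (Set.left_mem_Icc.2 zero_le_one) (Set.right_mem_Icc.2 zero_le_one)
  · have e1 : ∏ i ∈ s, (1 + (√(b i) + 1 * h i) ^ 2)⁻¹ = ∏ i ∈ s, (1 + a i)⁻¹ :=
      Finset.prod_congr rfl fun i hi => by simp [hh, Real.sq_sqrt (ha i hi).1]
    have e0 : ∏ i ∈ s, (1 + (√(b i) + 0 * h i) ^ 2)⁻¹ = ∏ i ∈ s, (1 + b i)⁻¹ :=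
      Finset.prod_congr rfl fun i hi => by simp [Real.sq_sqrt (hb i hi).1]
    rw [e1, e0] at hmv
    simpa using hmv
  · rintro τ ⟨h0, h1⟩
    have hu : ∀ i, √(b i) + τ * h i = (1 - τ) * √(b i) + τ * √(a i) := fun i => by
      simp only [hh]; ring
    have hu0 : ∀ i, 0 ≤ √(b i) + τ * h i := fun i => by
      rw [hu]
      have : 0 ≤ 1 - τ := by linarith
      positivity
    have hul : ∀ i ∈ s, (√(b i) + τ * h i) ^ 2 ≤ lam := fun i hi => by
      have h2 : √(b i) + τ * h i ≤ √lam := by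
        rw [hu]
        have hA := Real.sqrt_le_sqrt (ha i hi).2
        have hB := Real.sqrt_le_sqrt (hb i hi).2
        nlinarith
      calc (√(b i) + τ * h i) ^ 2 ≤ √lam ^ 2 := pow_le_pow_left₀ (hu0 i) h2 2
        _ = lam := Real.sq_sqrt hlam.le
    rw [norm_neg, norm_mul, Real.norm_eq_abs, Real.norm_eq_abs, abs_of_nonneg (Real.sqrt_nonneg _)]
    have hsum : |∑ i ∈ s, (√(b i) + τ * h i) * h i / (1 + (√(b i) + τ * h i) ^ 2)| ≤
        (∑ i ∈ s, (√(b i) + τ * h i)) * M := by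
      rw [Finset.sum_mul]
      refine (Finset.abs_sum_le_sum_abs _ _).trans (Finset.sum_le_sum fun i hi => ?_)
      have hq : 0 ≤ (√(b i) + τ * h i) ^ 2 := sq_nonneg _
      rw [abs_div, abs_mul, abs_of_nonneg (hu0 i), abs_of_pos (by linarith : 0 < 1 + (√(b i) + τ * h i) ^ 2)]
      have hp : 0 ≤ (√(b i) + τ * h i) * |h i| := mul_nonneg (hu0 i) (abs_nonneg _)
      exact (div_le_self hp (by linarith)).trans (mul_le_mul_of_nonneg_left (hM i hi) (hu0 i))
    calc _ ≤ √(lam * ∏ i ∈ s, (1 + (√(b i) + τ * h i) ^ 2)⁻¹) *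
          ((∑ i ∈ s, (√(b i) + τ * h i)) * M) := by gcongr
      _ = (√(lam * ∏ i ∈ s, (1 + (√(b i) + τ * h i) ^ 2)⁻¹) *
          ∑ i ∈ s, (√(b i) + τ * h i)) * M := by ring
      _ ≤ κ * M := by
          gcongr
          exact sqrt_update_mul_sum_le s hlam hκ hs _ hul

lemma lambdaC_mul_le (m : ℕ) (hm : 1 ≤ m) :
    0 ≤ lambdaC (m + 2) ∧ lambdaC (m + 2) * (m + 2 : ℕ) ≤ Real.exp 1 * (1 + 5 / m) := by
  have hm' : (1 : ℝ) ≤ m := by exact_mod_cast hm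
  have h0 : (0 : ℝ) < m := by linarith
  have heq : lambdaC (m + 2) = (1 + (m : ℝ)⁻¹) ^ m * ((m + 1) / m ^ 2) := by
    have h1 : 1 + (m : ℝ)⁻¹ = (m + 1) / m := by field_simp
    rw [h1, div_pow, lambdaC, show m + 2 - 1 = m + 1 by omega]
    push_cast
    rw [show (m : ℝ) + 2 - 1 = m + 1 by ring, show (m : ℝ) + 2 - 2 = m by ring, pow_succ, pow_add]
    field_simp
  have hexp : (1 + (m : ℝ)⁻¹) ^ m ≤ Real.exp 1 := by
    calc (1 + (m : ℝ)⁻¹) ^ m ≤ Real.exp ((m : ℝ)⁻¹) ^ m := by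
          gcongr
          linarith [Real.add_one_le_exp ((m : ℝ)⁻¹)]
      _ = Real.exp 1 := by rw [← Real.exp_nat_mul, mul_inv_cancel₀ h0.ne']
  rw [heq]
  refine ⟨by positivity, ?_⟩
  push_cast
  rw [mul_assoc]
  refine mul_le_mul hexp ?_ (by positivity) (Real.exp_pos _).le
  rw [div_mul_eq_mul_div, div_le_iff₀ (by positivity)]
  have : (1 + 5 / (m : ℝ)) * m ^ 2 = m ^ 2 + 5 * m := by field_simp
  rw [this]
  nlinarith

lemma exists_lambdaC_le {a : ℝ} (ha : 0 < a) :
    ∃ N : ℕ, ∀ n ≥ N, 0 ≤ lambdaC n ∧ lambdaC n ≤ a ∧ lambdaC n * n ≤ Real.exp 1 * (1 + a) := by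
  obtain ⟨k, hk⟩ := exists_nat_ge (18 / a)
  refine ⟨k + 3, fun n hn => ?_⟩
  obtain ⟨m, rfl⟩ : ∃ m, n = m + 2 := ⟨n - 2, by omega⟩
  have hm : 1 ≤ m := by omega
  obtain ⟨h0, h1⟩ := lambdaC_mul_le m hm
  have hm' : (1 : ℝ) ≤ m := by exact_mod_cast hm
  have hkm : (k : ℝ) ≤ m := by exact_mod_cast (by omega : k ≤ m)
  have h18 : 18 ≤ a * m := by
    rw [div_le_iff₀ ha] at hk
    nlinarith
  have h5 : 5 / (m : ℝ) ≤ a := by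
    rw [div_le_iff₀ (by linarith)]
    linarith
  have h55 : 5 / (m : ℝ) ≤ 5 := div_le_self (by norm_num) hm'
  have he := Real.exp_one_lt_d9
  have he0 := Real.exp_pos 1
  refine ⟨h0, ?_, h1.trans (by gcongr)⟩
  push_cast at h1
  have h6 : lambdaC (m + 2) * m ≤ 18 := by nlinarith
  by_contra! hcon
  nlinarith

section

variable {V : Type} [Fintype V] [DecidableEq V] (G : SimpleGraph V) [DecidableRel G.Adj]

lemma bpIter_mem_Icc {lam : ℝ} (hlam : 0 < lam) {R : V → V → ℝ}
    (hR : ∀ a b, R a b ∈ Set.Icc 0 lam) (v p : V) : bpIter G lam R v p ∈ Set.Icc 0 lam := by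
  have h1 : ∀ w, 0 ≤ (1 + R w v)⁻¹ := fun w => inv_nonneg.2 (by linarith [(hR w v).1])
  refine ⟨mul_nonneg hlam.le (Finset.prod_nonneg fun w _ => h1 w),
    mul_le_of_le_one_right hlam.le (Finset.prod_le_one (fun w _ => h1 w) fun w _ => ?_)⟩
  exact inv_le_one_of_one_le₀ (by linarith [(hR w v).1])

lemma iterate_bpIter_mem_Icc {lam : ℝ} (hlam : 0 < lam) {R : V → V → ℝ}
    (hR : ∀ a b, R a b ∈ Set.Icc 0 lam) (t : ℕ) (v p : V) :
    (bpIter G lam)^[t] R v p ∈ Set.Icc 0 lam := by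
  induction t generalizing v p with
  | zero => exact hR v p
  | succ t ih =>
    rw [Function.iterate_succ_apply']
    exact bpIter_mem_Icc G hlam ih v p

/-- The parentless fixed point is almost fixed by the message updates. -/
lemma abs_sqrt_bpIter_sub_le {lam : ℝ} (hlam : 0 < lam) {ω : V → ℝ}
    (hω : ∀ u, ω u ∈ Set.Icc (0 : ℝ) 1) (hfix : bpF G lam ω = ω) (v p : V) :
    |√(bpIter G lam (fun w _ => lam * ω w) v p) - √(lam * ω v)| ≤ √lam * (lam / 2) := by
  have hle : ∀ u, lam * ω u ≤ lam := fun u => mul_le_of_le_one_right hlam.le (hω u).2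
  have h0 : ∀ u, 0 ≤ lam * ω u := fun u => mul_nonneg hlam.le (hω u).1
  by_cases hp : p ∈ G.neighborFinset v
  · have hprod : bpIter G lam (fun w _ => lam * ω w) v p = lam * ω v * (1 + lam * ω p) := by
      have h1 : (1 + lam * ω p)⁻¹ * ∏ w ∈ (G.neighborFinset v).erase p, (1 + lam * ω w)⁻¹ =
          ω v := by
        rw [Finset.mul_prod_erase _ (fun w => (1 + lam * ω w)⁻¹) hp]
        exact congrFun hfix v
      have h2 : 1 + lam * ω p ≠ 0 := by linarith [h0 p]
      rw [bpIter, ← h1]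
      field_simp
    rw [hprod, Real.sqrt_mul (h0 v)]
    have h3 : 1 ≤ √(1 + lam * ω p) := Real.one_le_sqrt.2 (by linarith [h0 p])
    have h4 : √(1 + lam * ω p) ≤ 1 + lam * ω p / 2 := by
      refine Real.sqrt_le_iff.2 ⟨by linarith [h0 p], by nlinarith [h0 p]⟩
    have h5 : √(lam * ω v) ≤ √lam := Real.sqrt_le_sqrt (hle v)
    rw [show √(lam * ω v) * √(1 + lam * ω p) - √(lam * ω v) =
      √(lam * ω v) * (√(1 + lam * ω p) - 1) by ring, abs_of_nonneg (by
        exact mul_nonneg (Real.sqrt_nonneg _) (by linarith))]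
    exact mul_le_mul h5 (by linarith [hle p]) (by linarith) (Real.sqrt_nonneg _)
  · have : bpIter G lam (fun w _ => lam * ω w) v p = lam * ω v := by
      rw [bpIter, Finset.erase_eq_of_notMem hp]
      exact congrArg (lam * ·) (congrFun hfix v)
    rw [this, sub_self, abs_zero]
    positivity

lemma abs_sqrt_iterate_bpIter_sub_le {lam κ : ℝ} (hlam : 0 < lam) (hκ : 0 ≤ κ) (hκ1 : κ < 1)
    (hdeg : lam * G.maxDegree * (1 + lam) ≤ κ ^ 2 * Real.exp 1) {ω : V → ℝ}
    (hω : ∀ u, ω u ∈ Set.Icc (0 : ℝ) 1) (hfix : bpF G lam ω = ω) {R : V → V → ℝ}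
    (hR : ∀ a b, R a b ∈ Set.Icc 0 lam) (t : ℕ) (v p : V) :
    |√((bpIter G lam)^[t] R v p) - √(lam * ω v)| ≤ √lam * (κ ^ t + lam / (2 * (1 - κ))) := by
  have hmem : ∀ u, lam * ω u ∈ Set.Icc 0 lam := fun u =>
    ⟨mul_nonneg hlam.le (hω u).1, mul_le_of_le_one_right hlam.le (hω u).2⟩
  have hκ' : 0 < 1 - κ := by linarith
  induction t generalizing v p with
  | zero =>
    have h1 : |√(R v p) - √(lam * ω v)| ≤ √lam := by
      have hA := Real.sqrt_le_sqrt (hR v p).2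
      have hB := Real.sqrt_le_sqrt (hmem v).2
      rw [abs_le]
      constructor <;> linarith [Real.sqrt_nonneg (R v p), Real.sqrt_nonneg (lam * ω v)]
    refine h1.trans (le_mul_of_one_le_right (Real.sqrt_nonneg _) ?_)
    have : 0 ≤ lam / (2 * (1 - κ)) := by positivity
    simpa using this
  | succ t ih =>
    rw [Function.iterate_succ_apply']
    have hcard : ((((G.neighborFinset v).erase p).card : ℕ) : ℝ) ≤ G.maxDegree := by
      exact_mod_cast (Finset.card_erase_le).trans (G.degree_le_maxDegree v)
    have hc := abs_sqrt_update_sub_le ((G.neighborFinset v).erase p) hlam hκ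
      (le_trans (by gcongr) hdeg) (fun w => (bpIter G lam)^[t] R w v) (fun w => lam * ω w)
      (fun w _ => iterate_bpIter_mem_Icc G hlam hR t w v) (fun w _ => hmem w)
      (fun w _ => ih w v) (by positivity)
    have hd := abs_sqrt_bpIter_sub_le G hlam hω hfix v p
    refine (abs_sub_le _ _ _).trans ((add_le_add hc hd).trans (le_of_eq ?_))
    field_simp
    ring

end

lemma exp_neg_le_bpF_fixedPoint {V : Type} [Fintype V] (G : SimpleGraph V)
    [DecidableRel G.Adj] {lam c : ℝ} (hlam : 0 < lam) (hdeg : lam * G.maxDegree ≤ c)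
    {ω : V → ℝ} (hω : ∀ u, ω u ∈ Set.Icc (0 : ℝ) 1) (hfix : bpF G lam ω = ω) (v : V) :
    Real.exp (-c) ≤ ω v := by
  have hd : ((G.neighborFinset v).card : ℝ) ≤ G.maxDegree := by
    exact_mod_cast G.degree_le_maxDegree v
  calc Real.exp (-c) ≤ Real.exp ((G.neighborFinset v).card * -lam) :=
        Real.exp_le_exp.2 (by nlinarith)
    _ = ∏ _u ∈ G.neighborFinset v, Real.exp (-lam) := by
        rw [Real.exp_nat_mul, Finset.prod_const]
    _ ≤ ∏ u ∈ G.neighborFinset v, (1 + lam * ω u)⁻¹ := by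
        refine Finset.prod_le_prod (fun _ _ => (Real.exp_pos _).le) fun u _ => ?_
        have h0 : 0 ≤ lam * ω u := mul_nonneg hlam.le (hω u).1
        have h1 : lam * ω u ≤ lam := mul_le_of_le_one_right hlam.le (hω u).2
        rw [Real.exp_neg]
        gcongr
        linarith [Real.add_one_le_exp lam]
    _ = ω v := congrFun hfix v

lemma abs_odds_ratio_sub_one_le {R r : ℝ} (hR : 0 ≤ R) (hr : 0 < r) :
    |R / (1 + R) / (r / (1 + r)) - 1| ≤ |R - r| / r := by
  have h : R / (1 + R) / (r / (1 + r)) - 1 = (R - r) / (r * (1 + R)) := by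
    field_simp
    ring
  rw [h, abs_div, abs_of_pos (by positivity : 0 < r * (1 + R))]
  gcongr
  nlinarith

theorem parent_BP_convergence :
    ∀ δ ε : ℝ, 0 < δ → 0 < ε →
    ∃ (Δ₀ : ℕ) (C : ℝ), 0 < C ∧
      ∀ (V : Type) [Fintype V] [DecidableEq V] (G : SimpleGraph V) [DecidableRel G.Adj]
        (Δ : ℕ) (lam : ℝ),
        G.maxDegree = Δ → Δ₀ ≤ Δ → 6 ≤ G.egirth →
        0 < lam → lam < (1 - δ) * lambdaC Δ →
        ∀ ωstar : V → ℝ, (∀ u : V, ωstar u ∈ Set.Icc (0 : ℝ) 1) →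
          bpF G lam ωstar = ωstar →
        ∃ qstar : V → V → ℝ,
          (∀ v p : V, G.Adj v p → qstar v p ∈ Set.Icc (0 : ℝ) 1) ∧
          ∀ R0 : V → V → ℝ, (∀ a b : V, R0 a b ∈ Set.Icc (0 : ℝ) lam) →
          ∀ t : ℕ, C ≤ (t : ℝ) →
          ∀ p v : V, G.Adj p v →
            |(((bpIter G lam)^[t] R0) v p / (1 + ((bpIter G lam)^[t] R0) v p)) /
                qstar v p - 1| ≤ ε ∧
            |qstar v p / (lam * ωstar v / (1 + lam * ωstar v)) - 1| ≤ ε := by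
  intro δ ε hδ hε
  rcases le_or_gt 1 δ with hδ1 | hδ1
  · obtain ⟨N, hN⟩ := exists_lambdaC_le one_pos
    refine ⟨N, 1, one_pos, ?_⟩
    intro V _ _ G _ Δ lam _ hΔ _ hlam hlt
    nlinarith [(hN Δ hΔ).1]
  set κ : ℝ := 1 - δ ^ 2 / 2 with hκ
  have hκ0 : 0 ≤ κ := by nlinarith
  have hκ1 : κ < 1 := by nlinarith [pow_pos hδ 2]
  set η : ℝ := ε / (4 * Real.exp 3) with hη
  have hη0 : 0 < η := by positivity
  obtain ⟨N, hN⟩ := exists_lambdaC_le (lt_min (by positivity : 0 < δ / 4)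
    (by positivity : 0 < η * δ ^ 2))
  obtain ⟨T, hT⟩ := exists_pow_lt_of_lt_one hη0 hκ1
  refine ⟨N, T + 1, by positivity, ?_⟩
  intro V _ _ G _ Δ lam hG hΔ _ hlam hlt ω hω hfix
  obtain ⟨hc0, hca, hcn⟩ := hN Δ hΔ
  have ha1 := min_le_left (δ / 4) (η * δ ^ 2)
  have ha2 := min_le_right (δ / 4) (η * δ ^ 2)
  have he0 := Real.exp_pos 1
  have hlc : lam ≤ lambdaC Δ := hlt.le.trans (mul_le_of_le_one_left hc0 (by linarith))
  have hcn' : lambdaC Δ * Δ ≤ Real.exp 1 * (1 + δ / 4) := hcn.trans (by gcongr)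
  have hdeg : lam * G.maxDegree * (1 + lam) ≤ κ ^ 2 * Real.exp 1 := by
    rw [hG]
    calc lam * Δ * (1 + lam) ≤ (1 - δ) * lambdaC Δ * Δ * (1 + δ / 4) := by
          gcongr
          linarith
      _ = (1 - δ) * (lambdaC Δ * Δ) * (1 + δ / 4) := by ring
      _ ≤ (1 - δ) * (Real.exp 1 * (1 + δ / 4)) * (1 + δ / 4) := by
          have : 0 ≤ 1 - δ := by linarith
          gcongr
      _ = ((1 - δ) * (1 + δ / 4) ^ 2) * Real.exp 1 := by ring
      _ ≤ κ ^ 2 * Real.exp 1 := by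
          gcongr
          rw [hκ]
          nlinarith [pow_pos hδ 2, pow_pos hδ 3, pow_pos hδ 4]
  have hdeg3 : lam * G.maxDegree ≤ 3 := by
    have h1 : lam * G.maxDegree ≤ lam * G.maxDegree * (1 + lam) :=
      le_mul_of_one_le_right (by positivity) (by linarith)
    have h2 : κ ^ 2 ≤ 1 := pow_le_one₀ hκ0 hκ1.le
    nlinarith [Real.exp_one_lt_d9]
  have hω3 := exp_neg_le_bpF_fixedPoint G hlam hdeg3 hω hfix
  have hr0 : ∀ v, 0 < lam * ω v := fun v =>
    mul_pos hlam ((Real.exp_pos _).trans_le (hω3 v))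
  refine ⟨fun v _ => lam * ω v / (1 + lam * ω v), fun v _ _ => ?_, ?_⟩
  · have := hr0 v
    exact ⟨by positivity, (div_le_one (by positivity)).2 (by linarith)⟩
  intro R0 hR0 t ht p v _
  have hr := hr0 v
  refine ⟨?_, by rw [div_self (by positivity)]; simpa using hε.le⟩
  have hmem := iterate_bpIter_mem_Icc G hlam hR0 t v p
  have hD := abs_sqrt_iterate_bpIter_sub_le G hlam hκ0 hκ1 hdeg hω hfix hR0 t v p
  generalize (bpIter G lam)^[t] R0 v p = R at hmem hD ⊢
  refine (abs_odds_ratio_sub_one_le hmem.1 hr).trans ?_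
  have hpow : κ ^ t ≤ η := by
    have hTt : T ≤ t := by
      have : (T : ℝ) ≤ t := by linarith
      exact_mod_cast this
    exact (pow_le_pow_of_le_one hκ0 hκ1.le hTt).trans hT.le
  have hlamη : lam / (2 * (1 - κ)) ≤ η := by
    have : 2 * (1 - κ) = δ ^ 2 := by rw [hκ]; ring
    rw [this, div_le_iff₀ (by positivity)]
    linarith
  have hsum : √R + √(lam * ω v) ≤ 2 * √lam := by
    have hA := Real.sqrt_le_sqrt hmem.2
    have hB : √(lam * ω v) ≤ √lam :=
      Real.sqrt_le_sqrt (mul_le_of_le_one_right hlam.le (hω v).2)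
    linarith
  have hfac : R - lam * ω v = (√R - √(lam * ω v)) * (√R + √(lam * ω v)) := by
    have hA := Real.sq_sqrt hmem.1
    have hB := Real.sq_sqrt hr.le
    linear_combination hB - hA
  have hdiff : |R - lam * ω v| ≤ 4 * lam * η := by
    rw [hfac, abs_mul, abs_of_nonneg (by positivity : 0 ≤ √R + √(lam * ω v))]
    calc _ ≤ √lam * (η + η) * (2 * √lam) := by
          refine mul_le_mul (hD.trans ?_) hsum (by positivity) (by positivity)
          gcongr
      _ = 4 * (√lam) ^ 2 * η := by ring
      _ = 4 * lam * η := by rw [Real.sq_sqrt hlam.le]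
  rw [div_le_iff₀ hr]
  refine hdiff.trans ?_
  have h4 : 4 * lam * η = ε * (lam * Real.exp (-3)) := by
    rw [hη, Real.exp_neg]
    field_simp
  rw [h4]
  have := hω3 v
  gcongr
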